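/- arXiv:1805.02911 — 3 statements merged into one kernel-verified Lean document; each statement's English description precedes it below -/
import Mathlib

section
/- Let n be a positive integer and a_1, ..., a_n pairwise distinct positive integers. If there exist nonnegative integers x_1, ..., x_n and t ≥ 2 with a_1·x_1 + ... + a_n·x_n = t·a_1·...·a_n, then the x_i can be partitioned: there exist nonnegative integers x_i^(j) for i in [1,n], j in [1,t], with sum over j of x_i^(j) equal to x_i for each i, and sum over i of a_i·x_i^(j) equal to a_1·...·a_n for each j. -/
theorem aux_sum_le_prod (s : Finset ℕ) (hs : ∀ a ∈ s, 0 < a) :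
    ∑ a ∈ s, a ≤ ∏ a ∈ s, a + 1 := by
  induction s using Finset.induction_on_max with
  | empty => simp
  | insert M s hM ih =>
    have hns : M ∉ s := fun h => lt_irrefl _ (hM M h)
    have hs' : ∀ a ∈ s, 0 < a := fun a h => hs a (Finset.mem_insert_of_mem h)
    have ih := ih hs'
    have hM0 : 0 < M := hs M (Finset.mem_insert_self _ _)
    rw [Finset.sum_insert hns, Finset.prod_insert hns]
    have hP : 0 < ∏ a ∈ s, a := Finset.prod_pos hs'
    rcases Nat.lt_or_ge 1 (∏ a ∈ s, a) with h | h
    · have hM2 : 2 ≤ M := by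
        by_contra hc
        have : s = ∅ := by
          rw [Finset.eq_empty_iff_forall_notMem]
          intro b hb
          have := hM b hb
          have := hs' b hb
          omega
        subst this
        simp at h
      nlinarith
    · have h1 : ∏ a ∈ s, a = 1 := by omega
      have hsub : s ⊆ {1} := by
        intro b hb
        have : b ∣ 1 := h1 ▸ Finset.dvd_prod_of_mem (fun a => a) hb
        simpa using this
      have : ∑ a ∈ s, a ≤ ∑ a ∈ ({1} : Finset ℕ), a := Finset.sum_le_sum_of_subset hsub
      rw [h1]
      simp at this
      omega

theorem aux_chain {n : ℕ} (N : ℕ) : ∀ (r : Fin n → ℕ), ∑ i, r i = N →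
    ∃ w : ℕ → Fin n → ℕ, Monotone w ∧ (∀ k, k ≤ N → ∑ i, w k i = k) ∧ ∀ k, w k ≤ r := by
  induction N with
  | zero =>
    intro r hr
    exact ⟨fun _ _ => 0, fun _ _ _ => le_rfl, fun k hk => by simp; omega,
      fun k i => Nat.zero_le _⟩
  | succ N ih =>
    intro r hr
    have : ∃ j, 0 < r j := by
      by_contra hc
      push Not at hc
      have : ∑ i, r i = 0 := Finset.sum_eq_zero (fun i _ => by have := hc i; omega)
      omega
    obtain ⟨j, hj⟩ := this
    have hle : (Pi.single j 1 : Fin n → ℕ) ≤ r := by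
      intro i
      by_cases hi : i = j
      · subst hi; simp; omega
      · simp [hi]
    obtain ⟨r', rfl⟩ := exists_add_of_le hle
    have hr' : ∑ i, r' i = N := by
      simp only [Pi.add_apply, Finset.sum_add_distrib, Finset.sum_pi_single', 
        Finset.sum_pi_single] at hr
      simp at hr
      omega
    obtain ⟨w, hw1, hw2, hw3⟩ := ih r' hr'
    have hrr : r' ≤ (Pi.single j 1 + r' : Fin n → ℕ) := le_add_self
    refine ⟨fun k => if k ≤ N then w k else Pi.single j 1 + r', ?_, ?_, ?_⟩
    · intro k l hkl
      dsimp only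
      split_ifs with h1 h2 h2
      · exact hw1 hkl
      · exact (hw3 k).trans hrr
      · omega
      · exact le_rfl
    · intro k hk
      dsimp only
      split_ifs with h1
      · exact hw2 k h1
      · rw [hr]; omega
    · intro k
      dsimp only
      split_ifs with h1
      · exact (hw3 k).trans hrr
      · exact le_rfl

theorem aux_zero_sum {n : ℕ} (a r : Fin n → ℕ) (d : ℕ) (hd : 0 < d)
    (hr : 0 < ∑ i, r i) (hdiv : d ∣ ∑ i, a i * r i) :
    ∃ z : Fin n → ℕ, z ≤ r ∧ 0 < ∑ i, z i ∧ d ∣ ∑ i, a i * z i ∧ ∑ i, z i ≤ d := by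
  rcases Nat.lt_or_ge (∑ i, r i) d with h | h
  · exact ⟨r, le_rfl, hr, hdiv, h.le⟩
  obtain ⟨w, hw1, hw2, hw3⟩ := aux_chain _ r rfl
  have key : ∃ k l, k < l ∧ l ≤ d ∧ (∑ i, a i * w k i) ≡ (∑ i, a i * w l i) [MOD d] := by
    obtain ⟨k, hk, l, hl, hkl, he⟩ := Finset.exists_ne_map_eq_of_card_lt_of_maps_to
      (s := Finset.range (d+1)) (t := Finset.range d) (f := fun k => (∑ i, a i * w k i) % d)
      (by simp) (by intro k _; simpa using Nat.mod_lt _ hd)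
    simp at hk hl
    rcases lt_or_gt_of_ne hkl with h | h
    · exact ⟨k, l, h, by omega, he⟩
    · exact ⟨l, k, h, by omega, he.symm⟩
  obtain ⟨k, l, hkl, hld, he⟩ := key
  obtain ⟨z, hz⟩ := exists_add_of_le (hw1 hkl.le)
  have hs : ∑ i, w l i = ∑ i, w k i + ∑ i, z i := by
    rw [hz]; simp [Finset.sum_add_distrib]
  have hs2 : ∑ i, a i * w l i = ∑ i, a i * w k i + ∑ i, a i * z i := by
    rw [hz]; simp [Finset.sum_add_distrib, mul_add]
  rw [hw2 l (by omega), hw2 k (by omega)] at hs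
  refine ⟨z, ?_, by omega, ?_, by omega⟩
  · refine le_trans ?_ (hw3 l)
    rw [hz]; exact le_add_self
  · have := (Nat.modEq_iff_dvd' (by omega)).1 he
    rwa [hs2, Nat.add_sub_cancel_left] at this

theorem aux_main {n : ℕ} (a x : Fin n → ℕ) (ha : ∀ i, 0 < a i) (P : ℕ) (i : Fin n)
    (hiP : a i ∣ P) (hge : P ≤ ∑ j, a j * x j) (hdv : a i ∣ ∑ j, a j * x j)
    (hx : ∀ j, j ≠ i → a j ≤ x i + 1) :
    ∃ y : Fin n → ℕ, y ≤ x ∧ ∑ j, a j * y j = P := by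
  classical
  obtain ⟨x', hx'⟩ : ∃ x' : Fin n → ℕ, x' = Function.update x i 0 := ⟨_, rfl⟩
  have hxx : x = x' + Pi.single i (x i) := by
    ext j
    by_cases hj : j = i
    · subst hj; simp [hx']
    · simp [hx', hj]
  have hx'i : x' i = 0 := by simp [hx']
  have hsingle : ∀ (y : Fin n → ℕ) (k : ℕ), ∑ j, a j * (y + Pi.single i k : Fin n → ℕ) j
      = ∑ j, a j * y j + a i * k := by
    intro y k
    simp [mul_add, Finset.sum_add_distrib, Pi.single_apply]
  have hsx : ∑ j, a j * x j = ∑ j, a j * x' j + a i * x i := by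
    conv_lhs => rw [hxx]
    exact hsingle _ _
  -- it suffices to find a good y
  suffices hsuff : ∃ y : Fin n → ℕ, y ≤ x' ∧ a i ∣ ∑ j, a j * y j ∧ ∑ j, a j * y j ≤ P ∧
      P < ∑ j, a j * y j + a i * (x i + 1) by
    obtain ⟨y, hy1, hy2, hy3, hy4⟩ := hsuff
    obtain ⟨k, hk⟩ := (Nat.dvd_sub hiP hy2)
    have hkx : k ≤ x i := by
      have : a i * k < a i * (x i + 1) := by omega
      have := Nat.lt_of_mul_lt_mul_left this
      omega
    refine ⟨y + Pi.single i k, ?_, ?_⟩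
    · rw [hxx]
      refine add_le_add hy1 ?_
      intro j
      by_cases hj : j = i
      · subst hj; simpa [hx'i] using hkx
      · simp [hj]
    · rw [hsingle]; omega
  let Q : ℕ → Prop := fun s => ∃ y : Fin n → ℕ, y ≤ x' ∧ a i ∣ ∑ j, a j * y j ∧
    ∑ j, a j * y j = s
  have hQ0 : Q 0 := ⟨0, fun j => Nat.zero_le _, by simp, by simp⟩
  have hspec := Nat.findGreatest_spec (P := Q) (Nat.zero_le P) hQ0
  have hleP := Nat.findGreatest_le (P := Q) P
  obtain ⟨y, hy1, hy2, hy3⟩ := hspec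
  refine ⟨y, hy1, hy2, by omega, ?_⟩
  obtain ⟨r, hr⟩ := exists_add_of_le hy1
  have hsr : ∑ j, a j * x' j = ∑ j, a j * y j + ∑ j, a j * r j := by
    rw [hr]; simp [Finset.sum_add_distrib, mul_add]
  have hai := ha i
  rcases Nat.eq_zero_or_pos (∑ j, r j) with h0 | h0
  · have : ∑ j, a j * r j = 0 := by
      apply Finset.sum_eq_zero
      intro j hj
      rw [(Finset.sum_eq_zero_iff.1 h0) j hj, mul_zero]
    rw [mul_add]
    omega
  have hdr : a i ∣ ∑ j, a j * r j := by
    rw [hsx, hsr] at hdv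
    have h1 := (Nat.dvd_add_left (Dvd.intro _ rfl)).1 hdv
    exact (Nat.dvd_add_right hy2).1 h1
  obtain ⟨z, hz1, hz2, hz3, hz4⟩ := aux_zero_sum a r (a i) hai h0 hdr
  have hsyz : ∑ j, a j * (y + z) j = ∑ j, a j * y j + ∑ j, a j * z j := by
    simp [Finset.sum_add_distrib, mul_add]
  have hzi : z i = 0 := by
    have h1 : z i ≤ r i := hz1 i
    have h2 : x' i = y i + r i := by rw [hr]; rfl
    omega
  have hzpos : 0 < ∑ j, a j * z j := by
    refine lt_of_lt_of_le hz2 (Finset.sum_le_sum fun j _ => ?_)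
    exact Nat.le_mul_of_pos_left _ (ha j)
  have hzle : ∑ j, a j * z j ≤ a i * (x i + 1) := by
    calc ∑ j, a j * z j ≤ ∑ j, (x i + 1) * z j := by
          refine Finset.sum_le_sum fun j _ => ?_
          by_cases hj : j = i
          · subst hj; simp [hzi]
          · exact Nat.mul_le_mul_right _ (hx j hj)
      _ = (x i + 1) * ∑ j, z j := by rw [Finset.mul_sum]
      _ ≤ (x i + 1) * a i := Nat.mul_le_mul_left _ hz4
      _ = _ := mul_comm _ _
  have hgt : P < ∑ j, a j * y j + ∑ j, a j * z j := by
    by_contra hc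
    push Not at hc
    have : Q (∑ j, a j * y j + ∑ j, a j * z j) :=
      ⟨y + z, by rw [hr]; exact add_le_add le_rfl hz1, by
        rw [hsyz]; exact dvd_add hy2 hz3, hsyz⟩
    have := Nat.le_findGreatest hc this
    omega
  omega

theorem aux_pick {n : ℕ} (hn : 0 < n) (a x : Fin n → ℕ) (ha : ∀ i, 0 < a i)
    (hinj : Function.Injective a) (t : ℕ) (ht : 1 ≤ t)
    (h : ∑ i, a i * x i = t * ∏ i, a i) :
    ∃ y : Fin n → ℕ, y ≤ x ∧ ∑ j, a j * y j = ∏ i, a i := by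
  classical
  rcases Nat.lt_or_ge t 2 with h2 | h2
  · have : t = 1 := by omega
    subst this
    exact ⟨x, le_rfl, by simpa using h⟩
  have hPpos : 0 < ∏ i, a i := Finset.prod_pos fun i _ => ha i
  by_cases hex : ∃ i, ∀ j, j ≠ i → a j ≤ x i + 1
  · obtain ⟨i, hi⟩ := hex
    have hd : a i ∣ ∏ i, a i := Finset.dvd_prod_of_mem a (Finset.mem_univ i)
    exact aux_main a x ha _ i hd (by rw [h]; nlinarith)
      (by rw [h]; exact Dvd.dvd.mul_left hd t) hi
  exfalso
  push Not at hex
  haveI : Nonempty (Fin n) := ⟨⟨0, hn⟩⟩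
  obtain ⟨m, hm⟩ := Finite.exists_max a
  obtain ⟨q, hqm, hq⟩ := hex m
  have hP := Finset.mul_prod_erase Finset.univ a (Finset.mem_univ m)
  have hS := Finset.add_sum_erase Finset.univ (fun i => a i * x i) (Finset.mem_univ m)
  have hSP : ∑ i ∈ Finset.univ.erase m, a i ≤ ∏ i ∈ Finset.univ.erase m, a i + 1 := by
    have := aux_sum_le_prod ((Finset.univ.erase m).image a) (by
      intro b hb
      obtain ⟨i, _, rfl⟩ := Finset.mem_image.1 hb
      exact ha i)
    rwa [Finset.sum_image (fun _ _ _ _ e => hinj e),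
      Finset.prod_image (fun _ _ _ _ e => hinj e)] at this
  have hP' : 0 < ∏ i ∈ Finset.univ.erase m, a i := Finset.prod_pos fun i _ => ha i
  have hqP : a q ≤ ∏ i ∈ Finset.univ.erase m, a i :=
    Nat.le_of_dvd hP' (Finset.dvd_prod_of_mem a (by simp [hqm]))
  have hb : ∑ i ∈ Finset.univ.erase m, a i * x i ≤ a m * ∑ i ∈ Finset.univ.erase m, a i := by
    rw [Finset.mul_sum]
    refine Finset.sum_le_sum fun i _ => ?_
    obtain ⟨j, _, hj⟩ := hex i
    have := hm j
    rw [mul_comm]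
    exact Nat.mul_le_mul_right _ (by omega)
  have hb2 : a m * x m + a m * ∑ i ∈ Finset.univ.erase m, a i
      < a m * (2 * ∏ i ∈ Finset.univ.erase m, a i) := by
    rw [← mul_add]
    exact Nat.mul_lt_mul_of_pos_left (by omega) (ha m)
  have : 2 * ∏ i, a i ≤ t * ∏ i, a i := Nat.mul_le_mul_right _ h2
  rw [← h, ← hS, ← hP] at this
  have e : a m * (2 * ∏ i ∈ Finset.univ.erase m, a i)
    = 2 * (a m * ∏ i ∈ Finset.univ.erase m, a i) := by ring
  omega

theorem aux_all {n : ℕ} (hn : 0 < n) (a : Fin n → ℕ) (ha : ∀ i, 0 < a i)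
    (hinj : Function.Injective a) (t : ℕ) : ∀ (x : Fin n → ℕ)
    (_ : ∑ i, a i * x i = t * ∏ i, a i),
    ∃ y : Fin n → Fin t → ℕ,
      (∀ i, ∑ j, y i j = x i) ∧
      (∀ j, ∑ i, a i * y i j = ∏ i, a i) := by
  induction t with
  | zero =>
    intro x h
    refine ⟨fun _ _ => 0, fun i => ?_, fun j => j.elim0⟩
    rw [zero_mul] at h
    have := (Finset.sum_eq_zero_iff.1 h) i (Finset.mem_univ i)
    have h1 := ha i
    rcases Nat.mul_eq_zero.1 this with h2 | h2
    · omega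
    · simp [h2]
  | succ t ih =>
    intro x h
    obtain ⟨y, hy, hys⟩ := aux_pick hn a x ha hinj (t+1) (by omega) h
    obtain ⟨r, rfl⟩ := exists_add_of_le hy
    obtain ⟨w, hw1, hw2⟩ := ih r (by
      simp only [Pi.add_apply, mul_add, Finset.sum_add_distrib] at h
      rw [hys, add_mul] at h
      omega)
    refine ⟨fun i => Fin.cons (y i) (w i), fun i => ?_, fun j => ?_⟩
    · simp [Fin.sum_univ_succ, hw1]
    · refine Fin.cases ?_ (fun j => ?_) j
      · simpa using hys
      · simpa using hw2 j

theorem stmt1 (n : ℕ) (hn : 0 < n) (a x : Fin n → ℕ) (ha : ∀ i, 0 < a i)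
    (hinj : Function.Injective a) (t : ℕ) (ht : 2 ≤ t)
    (h : ∑ i, a i * x i = t * ∏ i, a i) :
    ∃ y : Fin n → Fin t → ℕ,
      (∀ i, ∑ j, y i j = x i) ∧
      (∀ j, ∑ i, a i * y i j = ∏ i, a i) := by
  exact aux_all hn a ha hinj t x h
end

section
/- Let G be an abelian group and g ∈ G an element of infinite order. For every n ≥ 2, the zero-sum sequence A = g^n · (−g)^n · (ng) · (−ng) has exactly two factorizations into atoms, namely U·(−U) with U = g^n·(−ng) and −U = (−g)^n·(ng), and V^n·V' with V = g·(−g), V' = (ng)·(−ng); consequently c(A) = n + 1. -/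
/-- A minimal zero-sum sequence over the abelian group `G`: a nonempty zero-sum
multiset none of whose proper nonempty sub-multisets has sum zero. -/
def IsMinZeroSum {G : Type*} [AddCommGroup G] (S : Multiset G) : Prop :=
  S ≠ 0 ∧ S.sum = 0 ∧ ∀ T ≤ S, T ≠ 0 → T.sum = 0 → T = S

/-- A factorization of a zero-sum sequence `B` into atoms of `B(G)`. -/
def IsFactorization {G : Type*} [AddCommGroup G] (B : Multiset G)
    (z : Multiset (Multiset G)) : Prop :=
  (∀ A ∈ z, IsMinZeroSum A) ∧ z.sum = B

/-- The usual distance between two factorizations. -/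
noncomputable def factDist {G : Type*} [AddCommGroup G] (z z' : Multiset (Multiset G)) : ℕ :=
  letI := Classical.decEq (Multiset G)
  max (z - z').card (z' - z).card

/-- The catenary degree of `B ∈ B(G)`: the least `N` such that any two factorizations
of `B` can be concatenated by a chain of factorizations with consecutive distances `≤ N`. -/
noncomputable def catenaryDeg {G : Type*} [AddCommGroup G] (B : Multiset G) : ℕ :=
  sInf {N : ℕ | ∀ z z', IsFactorization B z → IsFactorization B z' →
    Relation.ReflTransGen (fun x y => IsFactorization B y ∧ factDist x y ≤ N) z z'}

/-- The tame degree `t(A, U)` of `A ∈ B(G)` with respect to the atom `U`. -/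
noncomputable def tameDeg {G : Type*} [AddCommGroup G] (A U : Multiset G) : ℕ :=
  sInf {N : ℕ | ∀ z, IsFactorization A z →
    (∃ z', IsFactorization A z' ∧ U ∈ z') →
    ∃ z', IsFactorization A z' ∧ U ∈ z' ∧ factDist z z' ≤ N}

/-- The set of (positive) tame degrees of `B(G)`. -/
noncomputable def TaSet (G : Type*) [AddCommGroup G] : Set ℕ :=
  {n | 0 < n ∧ ∃ A U : Multiset G, A.sum = 0 ∧ IsMinZeroSum U ∧ tameDeg A U = n}

/-- The Davenport constant of `G`: the supremum of lengths of minimal zero-sum sequences. -/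
noncomputable def davenport (G : Type*) [AddCommGroup G] : ℕ :=
  sSup {n : ℕ | ∃ A : Multiset G, IsMinZeroSum A ∧ A.card = n}


/-- The sequence `g^a (-g)^b (ng)^c (-ng)^d`. -/
def seqM {G : Type*} [AddCommGroup G] (g : G) (n a b c d : ℕ) : Multiset G :=
  Multiset.replicate a g + Multiset.replicate b (-g) + Multiset.replicate c (n • g)
    + Multiset.replicate d (-(n • g))

theorem le_add_split {α : Type*} {T S S' : Multiset α} (h : T ≤ S + S') :
    ∃ T1 T2, T1 ≤ S ∧ T2 ≤ S' ∧ T = T1 + T2 := by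
  classical
  refine ⟨T ∩ S, T - S, Multiset.inter_le_right, ?_, ?_⟩
  · exact tsub_le_iff_left.mpr h
  · rw [add_comm]; exact (Multiset.sub_add_inter T S).symm

section
variable {G : Type*} [AddCommGroup G] {g : G} {n : ℕ}

theorem le_seqM {T : Multiset G} {a b c d : ℕ} (h : T ≤ seqM g n a b c d) :
    ∃ a' b' c' d', a' ≤ a ∧ b' ≤ b ∧ c' ≤ c ∧ d' ≤ d ∧ T = seqM g n a' b' c' d' := by
  obtain ⟨T1, T4, h1, h4, rfl⟩ := le_add_split h
  obtain ⟨T5, T3, h5, h3, rfl⟩ := le_add_split h1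
  obtain ⟨T6, T2, h6, h2, rfl⟩ := le_add_split h5
  rw [Multiset.le_replicate_iff] at h6 h2 h3 h4
  obtain ⟨a', ha, rfl⟩ := h6
  obtain ⟨b', hb, rfl⟩ := h2
  obtain ⟨c', hc, rfl⟩ := h3
  obtain ⟨d', hd, rfl⟩ := h4
  exact ⟨a', b', c', d', ha, hb, hc, hd, rfl⟩

theorem seqM_mono {a b c d a' b' c' d' : ℕ} (ha : a' ≤ a) (hb : b' ≤ b) (hc : c' ≤ c)
    (hd : d' ≤ d) : seqM g n a' b' c' d' ≤ seqM g n a b c d :=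
  add_le_add (add_le_add (add_le_add (Multiset.replicate_mono _ ha)
    (Multiset.replicate_mono _ hb)) (Multiset.replicate_mono _ hc)) (Multiset.replicate_mono _ hd)

theorem seqM_card (a b c d : ℕ) : (seqM g n a b c d).card = a + b + c + d := by
  simp [seqM]

theorem seqM_ne_zero {a b c d : ℕ} : seqM g n a b c d ≠ 0 ↔ a + b + c + d ≠ 0 := by
  rw [← seqM_card (g := g) (n := n), Ne, Ne, Multiset.card_eq_zero]

theorem zsmul_zero_of (hg : addOrderOf g = 0) {x : ℤ} (h : x • g = 0) : x = 0 := by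
  rw [← addOrderOf_dvd_iff_zsmul_eq_zero, hg] at h
  simpa using h

theorem seqM_sum (hg : addOrderOf g = 0) (a b c d : ℕ) :
    (seqM g n a b c d).sum = 0 ↔ a + n * c = b + n * d := by
  have e : (seqM g n a b c d).sum = ((a : ℤ) - b + n * c - n * d) • g := by
    simp only [seqM, Multiset.sum_add, Multiset.sum_replicate, ← natCast_zsmul]
    module
  rw [e]
  constructor
  · intro h
    have := zsmul_zero_of hg h
    zify; linarith
  · intro h
    have : (a : ℤ) - b + n * c - n * d = 0 := by zify at h; linarith
    rw [this, zero_smul]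

theorem seqM_inj (hg : addOrderOf g = 0) (hn : 2 ≤ n) {a b c d a' b' c' d' : ℕ}
    (h : seqM g n a b c d = seqM g n a' b' c' d') : a = a' ∧ b = b' ∧ c = c' ∧ d = d' := by
  classical
  have key : ∀ x y : ℤ, x • g = y • g → x = y := by
    intro x y hxy
    have := zsmul_zero_of hg (x := x - y) (by rw [sub_smul, hxy, sub_self])
    linarith
  have e1 : (1 : ℤ) • g = g := one_zsmul g
  have e2 : (-1 : ℤ) • g = -g := by simp
  have e3 : (n : ℤ) • g = n • g := natCast_zsmul g n
  have e4 : (-n : ℤ) • g = -(n • g) := by simp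
  have d12 : g ≠ -g := fun h => by
    have := key 1 (-1) (by rw [e1, e2]; exact h)
    omega
  have d13 : g ≠ n • g := fun h => by
    have := key 1 n (by rw [e1, e3]; exact h)
    omega
  have d14 : g ≠ -(n • g) := fun h => by
    have := key 1 (-n) (by rw [e1, e4]; exact h)
    omega
  have d23 : -g ≠ n • g := fun h => by
    have := key (-1) n (by rw [e2, e3]; exact h)
    omega
  have d24 : -g ≠ -(n • g) := fun h => by
    have := key (-1) (-n) (by rw [e2, e4]; exact h)
    omega
  have d34 : n • g ≠ -(n • g) := fun h => by
    have := key n (-n) (by rw [e3, e4]; exact h)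
    omega
  have c1 := congrArg (Multiset.count g) h
  have c2 := congrArg (Multiset.count (-g)) h
  have c3 := congrArg (Multiset.count (n • g)) h
  have c4 := congrArg (Multiset.count (-(n • g))) h
  simp only [seqM, Multiset.count_add, Multiset.count_replicate, d12, d13, d14, d23, d24, d34,
    d12.symm, d13.symm, d14.symm, d23.symm, d24.symm, d34.symm, if_true, if_false] at c1 c2 c3 c4
  omega

theorem atom_iff (hg : addOrderOf g = 0) {a b c d : ℕ} :
    IsMinZeroSum (seqM g n a b c d) ↔ a + b + c + d ≠ 0 ∧ a + n * c = b + n * d ∧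
      ∀ a' b' c' d', a' ≤ a → b' ≤ b → c' ≤ c → d' ≤ d → a' + b' + c' + d' ≠ 0 →
        a' + n * c' = b' + n * d' → seqM g n a' b' c' d' = seqM g n a b c d := by
  unfold IsMinZeroSum
  rw [seqM_ne_zero, seqM_sum hg]
  refine and_congr_right fun _ => and_congr_right fun _ => ⟨?_, ?_⟩
  · intro h a' b' c' d' ha hb hc hd h0 hs
    exact h _ (seqM_mono ha hb hc hd) (seqM_ne_zero.2 h0) ((seqM_sum hg _ _ _ _).2 hs)
  · intro h T hT h0 hs
    obtain ⟨a', b', c', d', ha, hb, hc, hd, rfl⟩ := le_seqM hT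
    exact h a' b' c' d' ha hb hc hd (seqM_ne_zero.1 h0) ((seqM_sum hg _ _ _ _).1 hs)

theorem atom_V (hg : addOrderOf g = 0) (hn : 2 ≤ n) : IsMinZeroSum (seqM g n 1 1 0 0) := by
  rw [atom_iff hg]
  refine ⟨by omega, by omega, ?_⟩
  intro a b c d ha hb hc hd h0 hs
  obtain rfl : c = 0 := by omega
  obtain rfl : d = 0 := by omega
  obtain rfl : a = 1 := by omega
  obtain rfl : b = 1 := by omega
  rfl

theorem atom_V' (hg : addOrderOf g = 0) (hn : 2 ≤ n) : IsMinZeroSum (seqM g n 0 0 1 1) := by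
  rw [atom_iff hg]
  refine ⟨by omega, by omega, ?_⟩
  intro a b c d ha hb hc hd h0 hs
  obtain rfl : a = 0 := by omega
  obtain rfl : b = 0 := by omega
  interval_cases c <;> interval_cases d <;> first | rfl | omega

theorem atom_U (hg : addOrderOf g = 0) (hn : 2 ≤ n) : IsMinZeroSum (seqM g n n 0 0 1) := by
  rw [atom_iff hg]
  refine ⟨by omega, by omega, ?_⟩
  intro a b c d ha hb hc hd h0 hs
  obtain rfl : c = 0 := by omega
  obtain rfl : b = 0 := by omega
  interval_cases d
  · omega
  · obtain rfl : a = n := by omega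
    rfl

theorem atom_U' (hg : addOrderOf g = 0) (hn : 2 ≤ n) : IsMinZeroSum (seqM g n 0 n 1 0) := by
  rw [atom_iff hg]
  refine ⟨by omega, by omega, ?_⟩
  intro a b c d ha hb hc hd h0 hs
  obtain rfl : a = 0 := by omega
  obtain rfl : d = 0 := by omega
  interval_cases c
  · omega
  · obtain rfl : b = n := by omega
    rfl

theorem atom_cases (hg : addOrderOf g = 0) {A : Multiset G}
    (hA : A ≤ seqM g n n n 1 1) (h : IsMinZeroSum A) :
    A = seqM g n 1 1 0 0 ∨ A = seqM g n 0 0 1 1 ∨ A = seqM g n n 0 0 1 ∨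
      A = seqM g n 0 n 1 0 := by
  obtain ⟨a, b, c, d, ha, hb, hc, hd, rfl⟩ := le_seqM hA
  rw [atom_iff hg] at h
  obtain ⟨h0, hs, hm⟩ := h
  by_cases hab : 1 ≤ a ∧ 1 ≤ b
  · exact Or.inl (hm 1 1 0 0 hab.1 hab.2 (by omega) (by omega) (by omega) (by omega)).symm
  by_cases hcd : 1 ≤ c ∧ 1 ≤ d
  · exact Or.inr (Or.inl
      (hm 0 0 1 1 (by omega) (by omega) hcd.1 hcd.2 (by omega) (by omega)).symm)
  interval_cases c <;> interval_cases d
  · omega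
  · obtain rfl : b = 0 := by omega
    obtain rfl : a = n := by omega
    simp
  · obtain rfl : a = 0 := by omega
    obtain rfl : b = n := by omega
    simp
  · omega

theorem four_split {α : Type*} (V W X Y : α) (z : Multiset α)
    (h : ∀ A ∈ z, A = V ∨ A = W ∨ A = X ∨ A = Y) :
    ∃ p q r s, z = Multiset.replicate p V + Multiset.replicate q W + Multiset.replicate r X
      + Multiset.replicate s Y := by
  induction z using Multiset.induction_on with
  | empty => exact ⟨0, 0, 0, 0, by simp⟩
  | cons A z ih =>
    obtain ⟨p, q, r, s, hz⟩ := ih fun B hB => h B (Multiset.mem_cons_of_mem hB)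
    rcases h A (Multiset.mem_cons_self A z) with rfl | rfl | rfl | rfl
    · exact ⟨p + 1, q, r, s, by rw [hz, Multiset.replicate_succ]; simp [Multiset.cons_add]⟩
    · exact ⟨p, q + 1, r, s, by rw [hz, Multiset.replicate_succ]; simp [Multiset.cons_add]⟩
    · exact ⟨p, q, r + 1, s, by rw [hz, Multiset.replicate_succ]; simp [Multiset.cons_add]⟩
    · exact ⟨p, q, r, s + 1, by rw [hz, Multiset.replicate_succ]; simp [Multiset.cons_add]⟩

theorem seqM_add (a b c d a' b' c' d' : ℕ) : seqM g n a b c d + seqM g n a' b' c' d' =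
    seqM g n (a + a') (b + b') (c + c') (d + d') := by
  simp only [seqM, Multiset.replicate_add]
  abel

theorem seqM_nsmul (p a b c d : ℕ) : p • seqM g n a b c d =
    seqM g n (p * a) (p * b) (p * c) (p * d) := by
  simp only [seqM, nsmul_add, Multiset.nsmul_replicate]

theorem factorization_iff (hg : addOrderOf g = 0) (hn : 2 ≤ n) (z : Multiset (Multiset G)) :
    IsFactorization (seqM g n n n 1 1) z ↔
      z = {seqM g n n 0 0 1, seqM g n 0 n 1 0} ∨
      z = Multiset.replicate n (seqM g n 1 1 0 0) + {seqM g n 0 0 1 1} := by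
  constructor
  · rintro ⟨hz, hs⟩
    obtain ⟨p, q, r, s, rfl⟩ := four_split (seqM g n 1 1 0 0) (seqM g n 0 0 1 1)
      (seqM g n n 0 0 1) (seqM g n 0 n 1 0) z fun A hA =>
        atom_cases hg (hs ▸ Multiset.le_sum_of_mem hA) (hz A hA)
    simp only [Multiset.sum_add, Multiset.sum_replicate, seqM_nsmul, seqM_add] at hs
    obtain ⟨h1, h2, h3, h4⟩ := seqM_inj hg hn hs
    have hq : q = 0 ∨ q = 1 := by omega
    rcases hq with rfl | rfl
    · obtain rfl : r = 1 := by omega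
      obtain rfl : s = 1 := by omega
      obtain rfl : p = 0 := by omega
      left; simp
    · obtain rfl : r = 0 := by omega
      obtain rfl : s = 0 := by omega
      obtain rfl : p = n := by omega
      right; simp
  · rintro (rfl | rfl)
    · refine ⟨?_, ?_⟩
      · intro A hA
        simp only [Multiset.insert_eq_cons, Multiset.mem_cons, Multiset.mem_singleton] at hA
        rcases hA with rfl | rfl
        exacts [atom_U hg hn, atom_U' hg hn]
      · simp [seqM_add]
    · refine ⟨?_, ?_⟩
      · intro A hA
        rw [Multiset.mem_add, Multiset.mem_singleton] at hA
        rcases hA with hA | rfl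
        · rw [Multiset.eq_of_mem_replicate hA]; exact atom_V hg hn
        · exact atom_V' hg hn
      · simp [seqM_add, seqM_nsmul]

theorem factDist_comm (z z' : Multiset (Multiset G)) : factDist z z' = factDist z' z :=
  max_comm _ _

theorem dist_eq (hn : 2 ≤ n) : factDist ({seqM g n n 0 0 1, seqM g n 0 n 1 0})
      (Multiset.replicate n (seqM g n 1 1 0 0) + {seqM g n 0 0 1 1}) = n + 1 := by
  classical
  have hd : Disjoint ({seqM g n n 0 0 1, seqM g n 0 n 1 0} : Multiset (Multiset G))
      (Multiset.replicate n (seqM g n 1 1 0 0) + {seqM g n 0 0 1 1}) := by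
    rw [Multiset.disjoint_left]
    intro A hA hB
    have h1 : A.card = n + 1 := by
      simp only [Multiset.insert_eq_cons, Multiset.mem_cons, Multiset.mem_singleton] at hA
      rcases hA with rfl | rfl <;> rw [seqM_card] <;> omega
    have h2 : A.card = 2 := by
      rw [Multiset.mem_add, Multiset.mem_singleton] at hB
      rcases hB with hB | rfl
      · rw [Multiset.eq_of_mem_replicate hB, seqM_card]
      · rw [seqM_card]
    omega
  have aux : ∀ (D : DecidableEq (Multiset G)) (x y : Multiset (Multiset G)), Disjoint x y →
      x - y = x := by
    intro D x y h
    have := Multiset.sub_add_inter x y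
    rwa [Multiset.inter_eq_zero_iff_disjoint.2 h, add_zero] at this
  unfold factDist
  simp only [aux _ _ _ hd, aux _ _ _ hd.symm]
  simp
  omega

theorem cat_eq (hg : addOrderOf g = 0) (hn : 2 ≤ n) :
    catenaryDeg (seqM g n n n 1 1) = n + 1 := by
  have hF := factorization_iff hg hn
  have hD := dist_eq (g := g) hn
  generalize ({seqM g n n 0 0 1, seqM g n 0 n 1 0} : Multiset (Multiset G)) = z1 at hF hD
  generalize (Multiset.replicate n (seqM g n 1 1 0 0) + {seqM g n 0 0 1 1}) = z2 at hF hD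
  have f1 := (hF z1).2 (Or.inl rfl)
  have f2 := (hF z2).2 (Or.inr rfl)
  have hD' := hD
  rw [factDist_comm] at hD'
  have hne : z1 ≠ z2 := by
    rintro rfl
    simp [factDist] at hD
  have mem : n + 1 ∈ {N : ℕ | ∀ z z', IsFactorization (seqM g n n n 1 1) z →
      IsFactorization (seqM g n n n 1 1) z' → Relation.ReflTransGen
        (fun x y => IsFactorization (seqM g n n n 1 1) y ∧ factDist x y ≤ n + 1) z z'}
      := by
    intro z z' hz hz'
    rcases (hF z).1 hz with rfl | rfl <;> rcases (hF z').1 hz' with rfl | rfl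
    · exact Relation.ReflTransGen.refl
    · exact Relation.ReflTransGen.single ⟨f2, hD.le⟩
    · exact Relation.ReflTransGen.single ⟨f1, hD'.le⟩
    · exact Relation.ReflTransGen.refl
  refine le_antisymm (Nat.sInf_le mem) (le_csInf ⟨_, mem⟩ ?_)
  intro N hN
  by_contra hlt
  have all : ∀ y, Relation.ReflTransGen
      (fun x y => IsFactorization (seqM g n n n 1 1) y ∧ factDist x y ≤ N) z1 y → y = z1 := by
    intro y hy
    induction hy with
    | refl => rfl
    | tail _ hs ih =>
      subst ih
      rcases (hF _).1 hs.1 with h | h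
      · exact h
      · have := hs.2
        rw [h, hD] at this
        omega
  exact hne (all z2 (hN z1 z2 f1 f2)).symm

end

theorem stmt7 (G : Type*) [AddCommGroup G] (g : G) (hg : addOrderOf g = 0)
    (n : ℕ) (hn : 2 ≤ n) :
    (∀ z, IsFactorization
        (Multiset.replicate n g + Multiset.replicate n (-g) + {n • g, -(n • g)}) z ↔
      z = ({Multiset.replicate n g + {-(n • g)},
            Multiset.replicate n (-g) + {n • g}} : Multiset (Multiset G)) ∨
      z = Multiset.replicate n ({g, -g} : Multiset G) +
            {({n • g, -(n • g)} : Multiset G)}) ∧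
    catenaryDeg
      (Multiset.replicate n g + Multiset.replicate n (-g) + {n • g, -(n • g)}) = n + 1 := by
  have eA : Multiset.replicate n g + Multiset.replicate n (-g) + {n • g, -(n • g)}
      = seqM g n n n 1 1 := by
    simp only [seqM, Multiset.replicate_one, Multiset.insert_eq_cons, ← Multiset.singleton_add,
      add_assoc]
  have eU : Multiset.replicate n g + {-(n • g)} = seqM g n n 0 0 1 := by simp [seqM]
  have eU' : Multiset.replicate n (-g) + {n • g} = seqM g n 0 n 1 0 := by simp [seqM]
  have eV : ({g, -g} : Multiset G) = seqM g n 1 1 0 0 := by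
    simp [seqM, ← Multiset.singleton_add]
  have eV' : ({n • g, -(n • g)} : Multiset G) = seqM g n 0 0 1 1 := by
    simp [seqM, ← Multiset.singleton_add]
  rw [eA, eU, eU', eV, eV']
  exact ⟨factorization_iff hg hn, cat_eq hg hn⟩
end

section
/- Let G = C_2^r with r ≥ 4 even, basis (e_1, ..., e_r), and e_0 = e_1 + ... + e_r. Set U = e_0 · Π_{j=1}^r (e_0 + e_j). For ν ∈ [1, r], let V_0^(ν) = e_0 · (e_1+...+e_ν) · Π_{j=ν+1}^r e_j, V_i = (e_0+e_i) · Π_{j≠i} e_j for i ∈ [1, r], and A^(ν) = V_0^(ν) · Π_{j=1}^r V_j. Then U is an atom of B(G), A^(ν) has exactly one factorization divisible by U, and t(A^(ν), U) = 2 − ν + r²/2. -/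
/-- The basis element `e_i` of `C_2^r`. -/
def eb (r : ℕ) (i : Fin r) : Fin r → ZMod 2 := Pi.single i 1

/-- `e_0 = e_1 + ... + e_r`. -/
def e0 (r : ℕ) : Fin r → ZMod 2 := ∑ i, eb r i

/-- The atom `U = e_0 · Π_{j=1}^r (e_0 + e_j)`. -/
def Useq (r : ℕ) : Multiset (Fin r → ZMod 2) :=
  e0 r ::ₘ (Finset.univ.val.map fun j => e0 r + eb r j)

/-- `V_0^{(ν)} = e_0 · (e_1 + ... + e_ν) · Π_{j=ν+1}^r e_j`. -/
def V0seq (r ν : ℕ) : Multiset (Fin r → ZMod 2) :=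
  e0 r ::ₘ (∑ j ∈ Finset.univ.filter (fun j : Fin r => (j : ℕ) < ν), eb r j) ::ₘ
    ((Finset.univ.filter fun j : Fin r => ν ≤ (j : ℕ)).val.map (eb r))

/-- `V_i = (e_0 + e_i) · Π_{j ≠ i} e_j`. -/
def Vseq (r : ℕ) (i : Fin r) : Multiset (Fin r → ZMod 2) :=
  (e0 r + eb r i) ::ₘ ((Finset.univ.filter fun j : Fin r => j ≠ i).val.map (eb r))

/-- `A^{(ν)} = V_0^{(ν)} · Π_{j=1}^r V_j`. -/
def Aseq (r ν : ℕ) : Multiset (Fin r → ZMod 2) :=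
  V0seq r ν + ∑ i, Vseq r i

namespace TameAux

lemma eb_inj (r : ℕ) : Function.Injective (eb r) := by
  intro i j h
  have := congrFun h i
  by_contra hne
  simp [eb, Pi.single_apply, hne] at this

lemma eb_apply (r : ℕ) (i j : Fin r) : eb r i j = if j = i then 1 else 0 := by
  simp [eb, Pi.single_apply]

lemma sum_eb_apply (r : ℕ) (J : Finset (Fin r)) (i : Fin r) :
    (∑ j ∈ J, eb r j) i = if i ∈ J then 1 else 0 := by
  simp [Finset.sum_apply, eb_apply]

lemma e0_apply (r : ℕ) (i : Fin r) : e0 r i = 1 := by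
  simp [e0, Finset.sum_apply, eb_apply]

lemma msum_apply (r : ℕ) (y : Multiset (Fin r)) (i : Fin r) :
    (y.map (eb r)).sum i = (y.count i : ZMod 2) := by
  induction y using Multiset.induction_on with
  | empty => simp
  | cons a s ih =>
    simp only [Multiset.map_cons, Multiset.sum_cons, Pi.add_apply, ih, eb_apply,
      Multiset.count_cons]
    split_ifs <;> simp [add_comm]

lemma le_map_exists {α β : Type*} (f : α → β) (s : Multiset α) :
    ∀ T : Multiset β, T ≤ s.map f → ∃ u ≤ s, T = u.map f := by
  classical
  induction s using Multiset.induction_on with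
  | empty => intro T hT; exact ⟨0, le_rfl, by simpa using hT⟩
  | cons a s ih =>
    intro T hT
    rw [Multiset.map_cons] at hT
    by_cases h : f a ∈ T
    · obtain ⟨T1, rfl⟩ := Multiset.exists_cons_of_mem h
      obtain ⟨u, hu, rfl⟩ := ih T1 ((Multiset.cons_le_cons_iff _).1 hT)
      exact ⟨a ::ₘ u, (Multiset.cons_le_cons_iff _).2 hu, by simp⟩
    · obtain ⟨u, hu, rfl⟩ := ih T ((Multiset.le_cons_of_notMem h).1 hT)
      exact ⟨u, hu.trans (Multiset.le_cons_self _ _), rfl⟩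

lemma le_map_finset {α β : Type*} (f : α → β) (J : Finset α) (T : Multiset β)
    (hT : T ≤ J.val.map f) : ∃ K : Finset α, K ⊆ J ∧ T = K.val.map f := by
  obtain ⟨u, hu, rfl⟩ := le_map_exists f J.val T hT
  exact ⟨⟨u, Multiset.nodup_of_le hu J.nodup⟩, Finset.val_le_iff.1 hu, rfl⟩

lemma self_add (r : ℕ) (x : Fin r → ZMod 2) : x + x = 0 := by
  funext i; exact CharTwo.add_self_eq_zero _

lemma eq_of_add (r : ℕ) {x y : Fin r → ZMod 2} (h : x + y = 0) : x = y := by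
  have := self_add r y
  exact add_right_cancel (h.trans this.symm)

lemma sum_eb_inj (r : ℕ) {J K : Finset (Fin r)} (h : ∑ j ∈ J, eb r j = ∑ j ∈ K, eb r j) :
    J = K := by
  ext i
  have := congrFun h i
  rw [sum_eb_apply, sum_eb_apply] at this
  by_cases h1 : i ∈ J <;> by_cases h2 : i ∈ K <;> simp_all

/-- atoms of the shape `x · Π_J e_j` -/
lemma min1 (r : ℕ) (J : Finset (Fin r)) (hJ : J.Nonempty) :
    IsMinZeroSum ((∑ j ∈ J, eb r j) ::ₘ J.val.map (eb r)) := by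
  refine ⟨Multiset.cons_ne_zero, ?_, ?_⟩
  · rw [Multiset.sum_cons]; exact self_add r _
  · intro T hT hT0 hs
    by_cases h : (∑ j ∈ J, eb r j) ∈ T
    · obtain ⟨T1, rfl⟩ := Multiset.exists_cons_of_mem h
      obtain ⟨K, hK, rfl⟩ := le_map_finset _ _ _ ((Multiset.cons_le_cons_iff _).1 hT)
      rw [Multiset.sum_cons] at hs
      rw [← sum_eb_inj r (eq_of_add r hs)]
    · obtain ⟨K, hK, rfl⟩ := le_map_finset _ _ _ ((Multiset.le_cons_of_notMem h).1 hT)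
      have : K = ∅ := sum_eb_inj r (by rw [Finset.sum_empty]; exact hs)
      subst this
      simp at hT0

lemma min2 (r : ℕ) (J : Finset (Fin r)) (x y : Fin r → ZMod 2)
    (hxy : x + y = ∑ j ∈ J, eb r j)
    (hx : ∀ K ⊆ J, x ≠ ∑ j ∈ K, eb r j) (hy : ∀ K ⊆ J, y ≠ ∑ j ∈ K, eb r j) :
    IsMinZeroSum (x ::ₘ y ::ₘ J.val.map (eb r)) := by
  refine ⟨Multiset.cons_ne_zero, ?_, ?_⟩
  · rw [Multiset.sum_cons, Multiset.sum_cons, ← add_assoc, hxy]; exact self_add r _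
  · intro T hT hT0 hs
    by_cases h : x ∈ T
    · obtain ⟨T1, rfl⟩ := Multiset.exists_cons_of_mem h
      have hT1 := (Multiset.cons_le_cons_iff _).1 hT
      by_cases h' : y ∈ T1
      · obtain ⟨T2, rfl⟩ := Multiset.exists_cons_of_mem h'
        obtain ⟨K, hK, rfl⟩ := le_map_finset _ _ _ ((Multiset.cons_le_cons_iff _).1 hT1)
        rw [Multiset.sum_cons, Multiset.sum_cons, ← add_assoc, hxy] at hs
        rw [← sum_eb_inj r (eq_of_add r hs)]
      · obtain ⟨K, hK, rfl⟩ := le_map_finset _ _ _ ((Multiset.le_cons_of_notMem h').1 hT1)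
        rw [Multiset.sum_cons] at hs
        exact absurd (eq_of_add r hs) (hx K hK)
    · have hT1 := (Multiset.le_cons_of_notMem h).1 hT
      by_cases h' : y ∈ T
      · obtain ⟨T2, rfl⟩ := Multiset.exists_cons_of_mem h'
        obtain ⟨K, hK, rfl⟩ := le_map_finset _ _ _ ((Multiset.cons_le_cons_iff _).1 hT1)
        rw [Multiset.sum_cons] at hs
        exact absurd (eq_of_add r hs) (hy K hK)
      · obtain ⟨K, hK, rfl⟩ := le_map_finset _ _ _ ((Multiset.le_cons_of_notMem h').1 hT1)
        have : K = ∅ := sum_eb_inj r (by rw [Finset.sum_empty]; exact hs)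
        subst this
        simp at hT0

lemma sumf_apply (r : ℕ) (K : Finset (Fin r)) (i : Fin r) :
    (K.val.map fun j => e0 r + eb r j).sum i = (K.card : ZMod 2) + if i ∈ K then 1 else 0 := by
  change (∑ j ∈ K, (e0 r + eb r j)) i = _
  rw [Finset.sum_add_distrib, Pi.add_apply, sum_eb_apply]
  simp [e0_apply]

lemma minU (r : ℕ) (hr : 4 ≤ r) (hre : Even r) : IsMinZeroSum (Useq r) := by
  have hrz : ((r : ℕ) : ZMod 2) = 0 := (ZMod.natCast_eq_zero_iff_even).2 hre
  refine ⟨Multiset.cons_ne_zero, ?_, ?_⟩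
  · funext i
    rw [Useq, Multiset.sum_cons, Pi.add_apply, sumf_apply, e0_apply]
    simp [hrz]
    exact CharTwo.add_self_eq_zero _
  · intro T hT hT0 hs
    have h0 : (0 : ℕ) < r := by omega
    unfold Useq at hT ⊢
    by_cases h : e0 r ∈ T
    · obtain ⟨T1, rfl⟩ := Multiset.exists_cons_of_mem h
      obtain ⟨K, hK, rfl⟩ := le_map_finset _ _ _ ((Multiset.cons_le_cons_iff _).1 hT)
      have hs' : ∀ i, (1 : ZMod 2) + (K.card + if i ∈ K then 1 else 0) = 0 := by
        intro i
        have := congrFun hs i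
        rwa [Multiset.sum_cons, Pi.add_apply, sumf_apply, e0_apply] at this
      suffices K = Finset.univ by rw [this]
      rcases K.eq_empty_or_nonempty with rfl | ⟨a, ha⟩
      · have := hs' ⟨0, h0⟩
        simp at this
      · ext i
        have h1 := hs' a
        have h2 := hs' i
        by_cases hi : i ∈ K
        · simp [hi]
        · simp only [ha, hi, if_true, if_false] at h1 h2
          have := h1.trans h2.symm
          simp at this
    · obtain ⟨K, hK, rfl⟩ := le_map_finset _ _ _ ((Multiset.le_cons_of_notMem h).1 hT)
      have hs' : ∀ i, ((K.card : ZMod 2) + if i ∈ K then 1 else 0) = 0 := by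
        intro i
        have := congrFun hs i
        rwa [sumf_apply] at this
      exfalso
      have hne : K.Nonempty := by
        rw [Finset.nonempty_iff_ne_empty]; rintro rfl; simp at hT0
      obtain ⟨a, ha⟩ := hne
      have hu : K = Finset.univ := by
        ext i
        have h1 := hs' a
        have h2 := hs' i
        by_cases hi : i ∈ K
        · simp [hi]
        · simp only [ha, hi, if_true, if_false] at h1 h2
          have := h1.trans h2.symm
          simp at this
      have := hs' a
      simp [hu, hrz] at this

/-- the square atom -/
def sq (r : ℕ) (j : Fin r) : Multiset (Fin r → ZMod 2) := {eb r j, eb r j}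

lemma sq_min (r : ℕ) (j : Fin r) : IsMinZeroSum (sq r j) := by
  have := min1 r {j} (by simp)
  simpa [sq] using this

/-- atoms over the basis are squares -/
lemma atom_basis (r : ℕ) (C : Multiset (Fin r → ZMod 2)) (hC : IsMinZeroSum C)
    (h : ∀ x ∈ C, ∃ j, eb r j = x) : ∃ j, C = sq r j := by
  obtain ⟨y, rfl⟩ : ∃ y : Multiset (Fin r), C = y.map (eb r) := by
    clear hC
    induction C using Multiset.induction_on with
    | empty => exact ⟨0, rfl⟩
    | cons a s ih =>
      obtain ⟨y, rfl⟩ := ih (fun x hx => h x (Multiset.mem_cons_of_mem hx))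
      obtain ⟨j, rfl⟩ := h a (Multiset.mem_cons_self _ _)
      exact ⟨j ::ₘ y, by simp⟩
  obtain ⟨j, hj⟩ := Multiset.exists_mem_of_ne_zero (s := y) (by rintro rfl; exact hC.1 rfl)
  have hc := msum_apply r y j
  rw [hC.2.1, Pi.zero_apply] at hc
  have he : Even (y.count j) := (ZMod.natCast_eq_zero_iff_even).1 hc.symm
  have h1 : 1 ≤ y.count j := Multiset.one_le_count_iff_mem.2 hj
  have h2 : 2 ≤ y.count j := by obtain ⟨k, hk⟩ := he; omega
  have hle : sq r j ≤ y.map (eb r) := by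
    have := Multiset.map_le_map (f := eb r) (Multiset.le_count_iff_replicate_le.1 h2)
    simpa [sq, Multiset.replicate_succ] using this
  exact ⟨j, (hC.2.2 _ hle (sq_min r j).1 (sq_min r j).2.1).symm⟩

/-- `{j | j < ν}` -/
def low (r ν : ℕ) : Finset (Fin r) := Finset.univ.filter fun j : Fin r => (j : ℕ) < ν

/-- the element w -/
def w (r ν : ℕ) : Fin r → ZMod 2 := ∑ j ∈ low r ν, eb r j

/-- the atom W -/
def Wseq (r ν : ℕ) : Multiset (Fin r → ZMod 2) := w r ν ::ₘ (low r ν).val.map (eb r)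

/-- exponents of the squares -/
def y0 (r ν : ℕ) : Multiset (Fin r) :=
  ∑ j : Fin r, (if (j : ℕ) < ν then (r - 2) / 2 else r / 2) • ({j} : Multiset (Fin r))

/-- the special factorization -/
def zz (r ν : ℕ) : Multiset (Multiset (Fin r → ZMod 2)) :=
  Useq r ::ₘ Wseq r ν ::ₘ (y0 r ν).map (sq r)

lemma count_y0 (r ν : ℕ) (j : Fin r) :
    (y0 r ν).count j = if (j : ℕ) < ν then (r - 2) / 2 else r / 2 := by
  rw [y0, Multiset.count_sum']
  simp only [Multiset.count_nsmul, Multiset.count_singleton]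
  simp

lemma card_low (r ν : ℕ) (h : ν ≤ r) : (low r ν).card = ν := by
  rw [low, Fin.card_filter_val_lt]; simp [h]

lemma card_y0 (r ν : ℕ) (hr : 4 ≤ r) (hre : Even r) (h : ν ≤ r) :
    (y0 r ν).card + ν = r * r / 2 := by
  have h1 : (y0 r ν).card = ∑ j : Fin r, if (j : ℕ) < ν then (r - 2) / 2 else r / 2 := by
    rw [y0, Multiset.card_sum]; simp only [Multiset.card_nsmul, Multiset.card_singleton, smul_eq_mul, mul_one]
  obtain ⟨k, rfl⟩ := hre
  have h2 : (y0 (k + k) ν).card + ν = ∑ j : Fin (k + k), k := by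
    have h3 : ν = ∑ j : Fin (k + k), if (j : ℕ) < ν then 1 else 0 := by
      conv_lhs => rw [← card_low (k + k) ν h, low]
      rw [Finset.card_filter]
    refine (congrArg₂ (· + ·) h1 h3).trans ?_
    beta_reduce
    rw [← Finset.sum_add_distrib]
    apply Finset.sum_congr rfl
    intro j _
    split_ifs <;> omega
  rw [h2]
  simp only [Finset.sum_const, Finset.card_univ, Fintype.card_fin, smul_eq_mul]
  rw [show (k + k) * (k + k) = 2 * ((k + k) * k) by ring]
  omega

lemma sum_map_sq (r : ℕ) (y : Multiset (Fin r)) :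
    (y.map (sq r)).sum = (y + y).map (eb r) := by
  induction y using Multiset.induction_on with
  | empty => simp
  | cons a s ih =>
    simp only [Multiset.map_cons, Multiset.sum_cons, ih, Multiset.map_add, sq]
    simp only [Multiset.insert_eq_cons, ← Multiset.singleton_add]
    abel

lemma fmap_eq {α β : Type*} (J : Finset α) (g : α → β) :
    J.val.map g = ∑ j ∈ J, ({g j} : Multiset β) := by
  have h := Multiset.sum_map_singleton (J.val.map g)
  rw [Multiset.map_map] at h
  exact h.symm

lemma sumV (r : ℕ) : ∑ i, Vseq r i = (Finset.univ.val.map fun j => e0 r + eb r j) +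
    (∑ j : Fin r, (r - 1) • ({j} : Multiset (Fin r))).map (eb r) := by
  have h1 : ∀ i, Vseq r i = {e0 r + eb r i} +
      ((Finset.univ.filter fun j : Fin r => j ≠ i).val).map (eb r) := fun i => rfl
  simp only [h1]
  rw [Finset.sum_add_distrib, fmap_eq Finset.univ]
  congr 1
  have : (∑ i : Fin r, ((Finset.univ.filter fun j : Fin r => j ≠ i).val)) =
      ∑ j : Fin r, (r - 1) • ({j} : Multiset (Fin r)) := by
    ext a
    rw [Multiset.count_sum', Multiset.count_sum']
    simp only [Multiset.count_nsmul, Multiset.count_singleton]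
    have h2 : ∀ i : Fin r, Multiset.count a ((Finset.univ.filter fun j : Fin r => j ≠ i).val)
        = if i ≠ a then 1 else 0 := by
      intro i
      rw [Multiset.count_eq_of_nodup (Finset.nodup _)]
      simp [eq_comm]
    simp only [h2]
    rw [← Finset.card_filter, Finset.filter_ne', Finset.card_erase_of_mem (Finset.mem_univ _)]
    simp
  rw [← this]
  exact (map_sum (Multiset.mapAddMonoidHom (eb r))
    (fun i : Fin r => (Finset.univ.filter fun j : Fin r => j ≠ i).val) Finset.univ).symm

/-- exponents of basis elements in `A` -/
lemma A_eq (r ν : ℕ) (hr : 4 ≤ r) (hre : Even r) :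
    Aseq r ν = Useq r + (Wseq r ν + (y0 r ν + y0 r ν).map (eb r)) := by
  have key : (Finset.univ.filter fun j : Fin r => ν ≤ (j : ℕ)).val +
      (∑ j : Fin r, (r - 1) • ({j} : Multiset (Fin r))) = (low r ν).val + (y0 r ν + y0 r ν) := by
    ext a
    simp only [Multiset.count_add, count_y0, Multiset.count_sum', Multiset.count_nsmul,
      Multiset.count_singleton]
    rw [Multiset.count_eq_of_nodup (Finset.nodup _), Multiset.count_eq_of_nodup (Finset.nodup _)]
    simp only [low, Finset.mem_val, Finset.mem_filter, Finset.mem_univ, true_and]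
    simp only [mul_ite, mul_one, mul_zero, Finset.sum_ite_eq, Finset.mem_univ, if_true]
    obtain ⟨k, rfl⟩ := hre
    split_ifs <;> omega
  have key2 := congrArg (Multiset.map (eb r)) key
  rw [Multiset.map_add, Multiset.map_add] at key2
  have h0 : V0seq r ν = {e0 r} + ({w r ν} +
    ((Finset.univ.filter fun j : Fin r => ν ≤ (j : ℕ)).val.map (eb r))) := rfl
  have hU : Useq r = {e0 r} + (Finset.univ.val.map fun j => e0 r + eb r j) := rfl
  have hW : Wseq r ν = {w r ν} + (low r ν).val.map (eb r) := rfl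
  rw [Aseq, sumV, h0, hU, hW, add_assoc {w r ν}, ← key2]
  abel

lemma zz_fact (r ν : ℕ) (hr : 4 ≤ r) (hre : Even r) (hν1 : 1 ≤ ν) :
    IsFactorization (Aseq r ν) (zz r ν) := by
  constructor
  · intro B hB
    simp only [zz, Multiset.mem_cons, Multiset.mem_map] at hB
    rcases hB with rfl | rfl | ⟨j, _, rfl⟩
    · exact minU r hr hre
    · exact min1 r _ ⟨⟨0, by omega⟩, by simp [low]; omega⟩
    · exact sq_min r j
  · rw [zz, Multiset.sum_cons, Multiset.sum_cons, sum_map_sq, A_eq r ν hr hre]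

lemma squares_map (r : ℕ) (z : Multiset (Multiset (Fin r → ZMod 2)))
    (h : ∀ C ∈ z, ∃ j, C = sq r j) : ∃ y : Multiset (Fin r), z = y.map (sq r) := by
  induction z using Multiset.induction_on with
  | empty => exact ⟨0, rfl⟩
  | cons a s ih =>
    obtain ⟨y, rfl⟩ := ih (fun x hx => h x (Multiset.mem_cons_of_mem hx))
    obtain ⟨j, rfl⟩ := h a (Multiset.mem_cons_self _ _)
    exact ⟨j ::ₘ y, by simp⟩

lemma mem_sum_exists {α : Type*} (z : Multiset (Multiset α)) (x : α) (h : x ∈ z.sum) :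
    ∃ B ∈ z, x ∈ B := by
  exact Multiset.mem_join.1 h

lemma mem_le_sum {α : Type*} (z : Multiset (Multiset α)) (B : Multiset α) (h : B ∈ z) :
    B ≤ z.sum := by
  obtain ⟨t, rfl⟩ := Multiset.exists_cons_of_mem h
  rw [Multiset.sum_cons]; exact Multiset.le_add_right _ _

lemma zz_unique (r ν : ℕ) (hr : 4 ≤ r) (hre : Even r) (hν1 : 1 ≤ ν)
    (z : Multiset (Multiset (Fin r → ZMod 2)))
    (hz : IsFactorization (Aseq r ν) z) (hU : Useq r ∈ z) : z = zz r ν := by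
  obtain ⟨z1, rfl⟩ := Multiset.exists_cons_of_mem hU
  obtain ⟨hat, hs⟩ := hz
  rw [Multiset.sum_cons, A_eq r ν hr hre] at hs
  have hs1 := add_left_cancel hs
  have hwm : w r ν ∈ z1.sum := by rw [hs1]; simp [Wseq]
  obtain ⟨B, hB, hwB⟩ := mem_sum_exists _ _ hwm
  have hBle := mem_le_sum _ _ hB
  have hBat := hat B (Multiset.mem_cons_of_mem hB)
  obtain ⟨B', rfl⟩ := Multiset.exists_cons_of_mem hwB
  rw [hs1, Wseq, Multiset.cons_add, Multiset.cons_le_cons_iff, ← Multiset.map_add] at hBle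
  obtain ⟨y, -, rfl⟩ := le_map_exists _ _ _ hBle
  have hBW : w r ν ::ₘ y.map (eb r) = Wseq r ν := by
    have hWm := min1 r (low r ν) ⟨⟨0, by omega⟩, by simp [low]; omega⟩
    refine (hBat.2.2 (Wseq r ν) ?_ hWm.1 hWm.2.1).symm
    rw [Wseq, Multiset.cons_le_cons_iff]
    apply Multiset.map_le_map
    rw [Multiset.le_iff_subset (Finset.nodup _)]
    intro i hi
    by_contra hn
    have h1 := eq_of_add r ((Multiset.sum_cons _ _).symm.trans hBat.2.1)
    have h2 := congrFun h1 i
    rw [msum_apply, w, sum_eb_apply, Multiset.count_eq_zero_of_notMem hn,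
      if_pos (Finset.mem_val ▸ hi)] at h2
    simp at h2
  rw [hBW] at hB
  obtain ⟨z2, rfl⟩ := Multiset.exists_cons_of_mem hB
  rw [Multiset.sum_cons] at hs1
  have hs2 := add_left_cancel hs1
  obtain ⟨y, rfl⟩ := squares_map r z2 (by
    intro C hC
    apply atom_basis r C (hat C (by simp [hC]))
    intro x hx
    have := Multiset.mem_of_le (mem_le_sum _ _ hC) hx
    rw [hs2] at this
    obtain ⟨j, _, hj⟩ := Multiset.mem_map.1 this
    exact ⟨j, hj⟩)
  rw [sum_map_sq] at hs2
  have h3 := Multiset.map_injective (eb_inj r) hs2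
  have : y = y0 r ν := by
    ext a
    have := congrArg (Multiset.count a) h3
    simp only [Multiset.count_add] at this
    omega
  rw [zz, this]

lemma card_le_countP {α : Type*} (q : α → Prop) [DecidablePred q]
    (z : Multiset (Multiset α)) (h : ∀ C ∈ z, ∃ x ∈ C, q x) : z.card ≤ z.sum.countP q := by
  induction z using Multiset.induction_on with
  | empty => simp
  | cons a s ih =>
    have h1 := ih (fun x hx => h x (Multiset.mem_cons_of_mem hx))
    have h2 := Multiset.countP_pos.2 (h a (Multiset.mem_cons_self _ _))
    rw [Multiset.sum_cons, Multiset.countP_add, Multiset.card_cons]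
    omega

lemma exists_ne (r : ℕ) (hr : 4 ≤ r) (i j : Fin r) : ∃ k, k ≠ i ∧ k ≠ j := by
  have : ∃ k, k ∉ ({i, j} : Finset (Fin r)) := by
    by_contra h
    push Not at h
    have h1 : (Finset.univ : Finset (Fin r)) ⊆ {i, j} := fun k _ => h k
    have h2 := Finset.card_le_card h1
    have h3 := Finset.card_le_two (a := i) (b := j)
    simp at h2
    omega
  obtain ⟨k, hk⟩ := this
  exact ⟨k, by simpa using hk⟩

lemma e0_ne (r : ℕ) (hr : 4 ≤ r) (j : Fin r) : e0 r ≠ eb r j := by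
  intro h
  obtain ⟨k, hk, _⟩ := exists_ne r hr j j
  have := congrFun h k
  simp [e0_apply, eb_apply, hk] at this

lemma f_ne (r : ℕ) (hr : 4 ≤ r) (i j : Fin r) : e0 r + eb r i ≠ eb r j := by
  intro h
  obtain ⟨k, hk, hk'⟩ := exists_ne r hr i j
  have := congrFun h k
  simp [e0_apply, eb_apply, hk, hk'] at this

lemma eb_notMem_U (r : ℕ) (hr : 4 ≤ r) (j : Fin r) : eb r j ∉ Useq r := by
  intro h
  rw [Useq, Multiset.mem_cons, Multiset.mem_map] at h
  rcases h with h | ⟨i, _, h⟩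
  · exact e0_ne r hr j h.symm
  · exact f_ne r hr i j h

lemma nonsq_card (r ν : ℕ) (hr : 4 ≤ r) (hre : Even r)
    (z : Multiset (Multiset (Fin r → ZMod 2))) (hz : IsFactorization (Aseq r ν) z)
    [DecidablePred fun C => ∃ j, C = sq r j] :
    (z.filter fun C => ¬ ∃ j, C = sq r j).card ≤ r + 2 := by
  classical
  have h1 : ∀ C ∈ z.filter (fun C => ¬ ∃ j, C = sq r j), ∃ x ∈ C, ¬ ∃ j, eb r j = x := by
    intro C hC
    rw [Multiset.mem_filter] at hC
    by_contra hcon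
    push Not at hcon
    exact hC.2 (atom_basis r C (hz.1 C hC.1) hcon)
  refine (card_le_countP _ _ h1).trans ?_
  have h2 : (z.filter fun C => ¬ ∃ j, C = sq r j).sum ≤ Aseq r ν := by
    rw [← hz.2]
    conv_rhs => rw [← Multiset.filter_add_not (fun C => ∃ j, C = sq r j) z, Multiset.sum_add]
    exact Multiset.le_add_left _ _
  refine (Multiset.countP_le_of_le _ h2).trans ?_
  rw [A_eq r ν hr hre, Wseq, Multiset.cons_add, ← Multiset.map_add, Multiset.countP_add,
    Multiset.countP_cons]
  have h3 : Multiset.countP (fun x => ¬ ∃ j, eb r j = x)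
      (((low r ν).val + (y0 r ν + y0 r ν)).map (eb r)) = 0 := by
    rw [Multiset.countP_eq_zero]
    intro x hx
    obtain ⟨j, _, hj⟩ := Multiset.mem_map.1 hx
    push Not
    exact ⟨j, hj⟩
  rw [h3]
  have h4 := Multiset.countP_le_card (fun x => ¬ ∃ j, eb r j = x) (Useq r)
  have h5 : (Useq r).card = r + 1 := by simp [Useq]
  split_ifs <;> omega

lemma count_sum_ge (r : ℕ) (z : Multiset (Multiset (Fin r → ZMod 2))) (j : Fin r) :
    2 * z.count (sq r j) ≤ z.sum.count (eb r j) := by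
  induction z using Multiset.induction_on with
  | empty => simp
  | cons a s ih =>
    rw [Multiset.sum_cons, Multiset.count_add, Multiset.count_cons]
    split_ifs with h
    · subst h
      have : Multiset.count (eb r j) (sq r j) = 2 := by simp [sq]
      omega
    · omega

lemma sq_inj (r : ℕ) : Function.Injective (sq r) := by
  intro i j h
  have : eb r i ∈ sq r j := by rw [← h]; simp [sq]
  simp [sq] at this
  exact eb_inj r this

lemma sq_le (r ν : ℕ) (hr : 4 ≤ r) (hre : Even r)
    (z : Multiset (Multiset (Fin r → ZMod 2))) (hz : IsFactorization (Aseq r ν) z)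
    [DecidablePred fun C => ∃ j, C = sq r j] :
    (z.filter fun C => ∃ j, C = sq r j) ≤ zz r ν := by
  rw [Multiset.le_iff_count]
  intro B
  by_cases hB : ∃ j, B = sq r j
  · rw [Multiset.count_filter_of_pos (p := fun C => ∃ j, C = sq r j) hB]
    obtain ⟨j, rfl⟩ := hB
    have h1 := count_sum_ge r z j
    rw [hz.2, A_eq r ν hr hre, Multiset.count_add,
      Multiset.count_eq_zero_of_notMem (eb_notMem_U r hr j), Multiset.count_add,
      Multiset.count_map_eq_count' _ _ (eb_inj r), Wseq, Multiset.count_cons,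
      Multiset.count_map_eq_count' _ _ (eb_inj r), Multiset.count_add] at h1
    have h2 := Multiset.nodup_iff_count_le_one.1 (low r ν).nodup j
    have h3 : Multiset.count (sq r j) (zz r ν) ≥
        (y0 r ν).count j + if sq r j = Wseq r ν then 1 else 0 := by
      rw [zz, Multiset.count_cons, Multiset.count_cons,
        Multiset.count_map_eq_count' _ _ (sq_inj r)]
      omega
    have h4 : eb r j = w r ν → sq r j = Wseq r ν := by
      intro h
      have : low r ν = {j} := sum_eb_inj r (by rw [Finset.sum_singleton]; exact h.symm)
      rw [Wseq, ← h, this]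
      simp [sq]
    split_ifs at h1 h3 with h5 h6 <;> first | omega | exact absurd (h4 h5) h6
  · rw [Multiset.count_filter_of_neg (p := fun C => ∃ j, C = sq r j) hB]
    exact Nat.zero_le _

lemma factDist_le {G : Type*} [AddCommGroup G] (z z' D : Multiset (Multiset G)) (N : ℕ)
    (h : z ≤ z' + D) (hD : D.card ≤ N) (hz : z'.card ≤ N) : factDist z z' ≤ N := by
  unfold factDist
  let := Classical.decEq (Multiset G)
  refine max_le ?_ ?_
  · exact (Multiset.card_le_card (Multiset.sub_le_iff_le_add'.2 h)).trans hD
  · exact (Multiset.card_le_card (Multiset.sub_le_self _ _)).trans hz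

lemma le_factDist {G : Type*} [AddCommGroup G] (z z' : Multiset (Multiset G))
    (h : ∀ B ∈ z, B ∉ z') : z'.card ≤ factDist z z' := by
  unfold factDist
  refine le_max_of_le_right ?_
  apply Multiset.card_le_card
  letI := Classical.decEq (Multiset G)
  rw [Multiset.le_iff_count]
  intro B
  rw [Multiset.count_sub]
  by_cases hB : B ∈ z
  · rw [Multiset.count_eq_zero_of_notMem (h B hB)]; exact Nat.zero_le _
  · rw [Multiset.count_eq_zero_of_notMem hB]; simp

lemma f_eq (r : ℕ) (i : Fin r) :
    e0 r + eb r i = ∑ j ∈ Finset.univ.filter (fun j : Fin r => j ≠ i), eb r j := by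
  funext k
  rw [sum_eb_apply, Pi.add_apply, e0_apply, eb_apply]
  by_cases h : k = i <;> simp [h]
  decide

lemma V_min (r : ℕ) (hr : 4 ≤ r) (i : Fin r) : IsMinZeroSum (Vseq r i) := by
  rw [Vseq, f_eq]
  obtain ⟨k, hk, _⟩ := exists_ne r hr i i
  exact min1 r _ ⟨k, by simp [hk]⟩

lemma V_card (r : ℕ) (hr : 4 ≤ r) (i : Fin r) : (Vseq r i).card = r := by
  rw [Vseq, Multiset.card_cons, Multiset.card_map, Finset.card_val, Finset.filter_ne',
    Finset.card_erase_of_mem (Finset.mem_univ _)]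
  simp
  omega

lemma high_eq (r ν : ℕ) : (Finset.univ.filter fun j : Fin r => ν ≤ (j : ℕ)) = (low r ν)ᶜ := by
  ext; simp [low]

lemma V0_min (r ν : ℕ) (hr : 4 ≤ r) (hν1 : 1 ≤ ν) : IsMinZeroSum (V0seq r ν) := by
  have h0 : (⟨0, by omega⟩ : Fin r) ∈ low r ν := by simp [low]; omega
  rw [V0seq, high_eq]
  change IsMinZeroSum (e0 r ::ₘ w r ν ::ₘ _)
  apply min2
  · funext i
    rw [Pi.add_apply, e0_apply, w, sum_eb_apply, sum_eb_apply]
    by_cases h : i ∈ low r ν <;> simp [h]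
    decide
  · intro K hK h
    have := congrFun h ⟨0, by omega⟩
    rw [e0_apply, sum_eb_apply, if_neg] at this
    · simp at this
    · intro h'; exact Finset.mem_compl.1 (hK h') h0
  · intro K hK h
    have := sum_eb_inj r h
    rw [this] at h0
    exact Finset.mem_compl.1 (hK h0) (this ▸ h0)

lemma W_card (r ν : ℕ) (hνr : ν ≤ r) : (Wseq r ν).card = ν + 1 := by
  simp [Wseq, card_low r ν hνr]

lemma sq_card (r : ℕ) (j : Fin r) : (sq r j).card = 2 := by simp [sq]

lemma mem_zz (r ν : ℕ) {B : Multiset (Fin r → ZMod 2)} (h : B ∈ zz r ν) :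
    B = Useq r ∨ B = Wseq r ν ∨ ∃ j, B = sq r j := by
  simp only [zz, Multiset.mem_cons, Multiset.mem_map] at h
  rcases h with h | h | ⟨j, _, h⟩
  · exact Or.inl h
  · exact Or.inr (Or.inl h)
  · exact Or.inr (Or.inr ⟨j, h.symm⟩)

lemma U_card (r : ℕ) : (Useq r).card = r + 1 := by simp [Useq]

lemma exists_disjoint (r ν : ℕ) (hr : 4 ≤ r) (hre : Even r) (hν1 : 1 ≤ ν) (hνr : ν ≤ r) :
    ∃ z, IsFactorization (Aseq r ν) z ∧ ∀ B ∈ z, B ∉ zz r ν := by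
  by_cases hν : ν + 1 = r
  · -- the exceptional case
    let l : Fin r := ⟨ν, by omega⟩
    have hlow : low r ν = Finset.univ.filter (fun j : Fin r => j ≠ l) := by
      ext j
      simp only [low, Finset.mem_filter, Finset.mem_univ, true_and, l, ne_eq, Fin.ext_iff]
      omega
    have hw : w r ν = e0 r + eb r l := by rw [w, hlow, f_eq]
    have hl : (Finset.univ.filter fun j : Fin r => ν ≤ (j : ℕ)) = {l} := by
      rw [high_eq, hlow]; ext j; simp
    have huniv : Finset.univ.val.map (eb r) =
        {eb r l} + (Finset.univ.filter (fun j : Fin r => j ≠ l)).val.map (eb r) := by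
      rw [fmap_eq, fmap_eq, Finset.filter_ne', Finset.add_sum_erase _ (fun j => ({eb r j} : Multiset (Fin r → ZMod 2)))
        (Finset.mem_univ l)]
    have hV : ∑ i, Vseq r i =
        Vseq r l + ((Finset.univ.filter (fun j : Fin r => j ≠ l)).val.map (Vseq r)).sum := by
      rw [Finset.filter_ne']
      exact (Finset.add_sum_erase _ _ (Finset.mem_univ l)).symm
    refine ⟨((e0 r + eb r l) ::ₘ (e0 r + eb r l) ::ₘ (∅ : Finset (Fin r)).val.map (eb r)) ::ₘ
      (e0 r ::ₘ Finset.univ.val.map (eb r)) ::ₘ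
      (Finset.univ.filter (fun j : Fin r => j ≠ l)).val.map (Vseq r), ⟨?_, ?_⟩, ?_⟩
    · intro B hB
      simp only [Multiset.mem_cons, Multiset.mem_map] at hB
      have hne : ∀ K ⊆ (∅ : Finset (Fin r)), e0 r + eb r l ≠ ∑ j ∈ K, eb r j := by
        intro K hK h
        rw [Finset.subset_empty.1 hK, Finset.sum_empty] at h
        obtain ⟨k, hk, _⟩ := exists_ne r hr l l
        have := congrFun h k
        simp [e0_apply, eb_apply, hk] at this
      rcases hB with rfl | rfl | ⟨i, _, rfl⟩
      · exact min2 r ∅ _ _ (by rw [self_add]; simp) hne hne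
      · exact min1 r Finset.univ ⟨l, Finset.mem_univ _⟩
      · exact V_min r hr i
    · rw [Multiset.sum_cons, Multiset.sum_cons, Aseq, hV, huniv, V0seq, hl, Vseq]
      change _ = (e0 r ::ₘ w r ν ::ₘ _) + _
      rw [hw]
      simp only [← Multiset.singleton_add, Finset.empty_val, Multiset.map_zero,
        Finset.singleton_val, Multiset.map_singleton]
      abel
    · intro B hB hB'
      simp only [Multiset.mem_cons, Multiset.mem_map] at hB
      rcases hB with rfl | rfl | ⟨i, hi, rfl⟩
      · rcases mem_zz r ν hB' with h | h | ⟨j, h⟩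
        · have := congrArg Multiset.card h
          rw [U_card] at this
          simp at this
          omega
        · have := congrArg Multiset.card h
          rw [W_card r ν hνr] at this
          simp at this
          omega
        · have : e0 r + eb r l ∈ sq r j := by rw [← h]; exact Multiset.mem_cons_self _ _
          simp only [sq, Multiset.insert_eq_cons, Multiset.mem_cons, Multiset.mem_singleton,
            or_self] at this
          exact f_ne r hr l j this
      · rcases mem_zz r ν hB' with h | h | ⟨j, h⟩
        · apply eb_notMem_U r hr l
          rw [← h]
          exact Multiset.mem_cons_of_mem (Multiset.mem_map_of_mem _ (Finset.mem_univ l))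
        · have := congrArg Multiset.card h
          rw [W_card r ν hνr] at this
          simp at this
          omega
        · have := congrArg Multiset.card h
          rw [sq_card] at this
          simp at this
          omega
      · have hc := V_card r hr i
        rcases mem_zz r ν hB' with h | h | ⟨j, h⟩
        · rw [h, U_card] at hc; omega
        · have hil : i ∈ low r ν := by rw [hlow]; exact hi
          have h1 : eb r i ∈ Vseq r i := by
            rw [h]
            exact Multiset.mem_cons_of_mem (Multiset.mem_map_of_mem _ hil)
          rw [Vseq, Multiset.mem_cons, Multiset.mem_map] at h1
          rcases h1 with h1 | ⟨k, hk, h1⟩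
          · exact f_ne r hr i i h1.symm
          · have := eb_inj r h1
            subst this
            simp at hk
        · rw [h, sq_card] at hc; omega
  · refine ⟨V0seq r ν ::ₘ Finset.univ.val.map (Vseq r), ⟨?_, ?_⟩, ?_⟩
    · intro B hB
      rw [Multiset.mem_cons, Multiset.mem_map] at hB
      rcases hB with rfl | ⟨i, _, rfl⟩
      · exact V0_min r ν hr hν1
      · exact V_min r hr i
    · rw [Multiset.sum_cons]; rfl
    · intro B hB hB'
      rw [Multiset.mem_cons, Multiset.mem_map] at hB
      rcases hB with rfl | ⟨i, _, rfl⟩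
      · have hc : (V0seq r ν).card + ν = r + 2 := by
          rw [V0seq, high_eq]
          simp only [Multiset.card_cons, Multiset.card_map, Finset.card_val, Finset.card_compl,
            card_low r ν hνr, Fintype.card_fin]
          omega
        have he : e0 r ∈ V0seq r ν := Multiset.mem_cons_self _ _
        rcases mem_zz r ν hB' with h | h | ⟨j, h⟩
        · by_cases hlt : ν = r
          · have := congrArg Multiset.card h
            rw [U_card] at this
            omega
          · apply eb_notMem_U r hr ⟨ν, by omega⟩
            rw [← h, V0seq]
            simp only [Multiset.mem_cons, Multiset.mem_map]
            exact Or.inr (Or.inr ⟨_, by simp, rfl⟩)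
        · have hcc := congrArg Multiset.card h
          rw [W_card r ν hνr] at hcc
          rw [h, Wseq, Multiset.mem_cons, Multiset.mem_map] at he
          rcases he with he | ⟨j, _, he⟩
          · have h2 : Finset.univ = low r ν := sum_eb_inj r he
            have h3 := card_low r ν hνr
            rw [← h2] at h3
            simp at h3
            omega
          · exact e0_ne r hr j he.symm
        · rw [h] at he
          simp [sq] at he
          exact e0_ne r hr j he
      · have hc := V_card r hr i
        rcases mem_zz r ν hB' with h | h | ⟨j, h⟩
        · rw [h, U_card] at hc; omega
        · rw [h, W_card r ν hνr] at hc; omega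
        · rw [h, sq_card] at hc; omega

end TameAux

open TameAux in
theorem stmt15 (r ν : ℕ) (hr : 4 ≤ r) (hre : Even r) (hν1 : 1 ≤ ν) (hνr : ν ≤ r) :
    IsMinZeroSum (Useq r) ∧
    (∃! z, IsFactorization (Aseq r ν) z ∧ Useq r ∈ z) ∧
    tameDeg (Aseq r ν) (Useq r) + ν = 2 + r * r / 2 := by
  classical
  have hUz : Useq r ∈ zz r ν := Multiset.mem_cons_self _ _
  have hzf := zz_fact r ν hr hre hν1
  refine ⟨minU r hr hre, ⟨zz r ν, ⟨hzf, hUz⟩, fun z hz =>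
    zz_unique r ν hr hre hν1 z hz.1 hz.2⟩, ?_⟩
  have hcard : (zz r ν).card + ν = 2 + r * r / 2 := by
    have := card_y0 r ν hr hre hνr
    simp only [zz, Multiset.card_cons, Multiset.card_map]
    omega
  rw [← hcard]
  congr 1
  have hmem : (zz r ν).card ∈ {N : ℕ | ∀ z, IsFactorization (Aseq r ν) z →
    (∃ z', IsFactorization (Aseq r ν) z' ∧ Useq r ∈ z') →
    ∃ z', IsFactorization (Aseq r ν) z' ∧ Useq r ∈ z' ∧ factDist z z' ≤ N} := by
    intro z hz _
    refine ⟨zz r ν, hzf, hUz, factDist_le _ _ (z.filter fun C => ¬ ∃ j, C = sq r j) _ ?_ ?_ le_rfl⟩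
    · conv_lhs => rw [← Multiset.filter_add_not (fun C => ∃ j, C = sq r j) z]
      exact add_le_add_left (sq_le r ν hr hre z hz) _
    · refine (nonsq_card r ν hr hre z hz).trans ?_
      obtain ⟨k, rfl⟩ := hre
      rw [show (k + k) * (k + k) = 2 * (k * (k + k)) by ring] at hcard
      have : 2 * (k + k) ≤ k * (k + k) := Nat.mul_le_mul_right _ (by omega)
      omega
  unfold tameDeg
  refine le_antisymm (Nat.sInf_le hmem) (le_csInf ⟨_, hmem⟩ ?_)
  intro N hN
  obtain ⟨z, hz, hd⟩ := exists_disjoint r ν hr hre hν1 hνr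
  obtain ⟨z', hz', hU', hle⟩ := hN z hz ⟨zz r ν, hzf, hUz⟩
  rw [zz_unique r ν hr hre hν1 z' hz' hU'] at hle
  exact (le_factDist z _ hd).trans hle
end
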